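/- Let A and B be finite sets of points in ℝ² that are linearly separable, let a ≥ 2 and b ≥ 2 be integers, and suppose A is contained in a Jordan curve with stabbing number at most a and B is contained in a Jordan curve with stabbing number at most b. Then A ∪ B is contained in a Jordan curve with stabbing number at most a + b + 2. -/

import Mathlib

open Set

/-- Points of the plane. -/
abbrev Pt := ℝ × ℝ

/-- An affine line in ℝ², given by a nontrivial linear equation. -/
def IsAffLine (l : Set Pt) : Prop :=
  ∃ a b c : ℝ, (a ≠ 0 ∨ b ≠ 0) ∧ l = {p : Pt | a * p.1 + b * p.2 = c}

/-- An open half-plane in ℝ². -/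
def IsOpenHalfPlane (H : Set Pt) : Prop :=
  ∃ a b c : ℝ, (a ≠ 0 ∨ b ≠ 0) ∧ H = {p : Pt | a * p.1 + b * p.2 < c}

/-- `A` and `B` are linearly separable: some affine line has `A` strictly on
one side and `B` strictly on the other side. -/
def LinSep (A B : Set Pt) : Prop :=
  ∃ a b c : ℝ, (a ≠ 0 ∨ b ≠ 0) ∧ (∀ p ∈ A, a * p.1 + b * p.2 < c) ∧
    (∀ p ∈ B, c < a * p.1 + b * p.2)

/-- General position: no three (distinct) points of `X` are collinear. -/
def GenPos (X : Set Pt) : Prop :=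
  ∀ p ∈ X, ∀ q ∈ X, ∀ r ∈ X, p ≠ q → p ≠ r → q ≠ r →
    ¬ Collinear ℝ ({p, q, r} : Set Pt)

/-- Convex position: no point of `X` lies in the convex hull of the others. -/
def ConvexPos (X : Set Pt) : Prop :=
  ∀ p ∈ X, p ∉ convexHull ℝ (X \ {p})

/-- A cell of an arrangement `L` of lines: a connected component of the
complement of the union of the lines. -/
def IsCell (L : Set (Set Pt)) (cell : Set Pt) : Prop :=
  ∃ p ∈ (⋃₀ L)ᶜ, cell = connectedComponentIn (⋃₀ L)ᶜ p

/-- `S` has at most `d` connected components: among any `d + 1` points of `S`,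
two lie in the same connected component of `S`. -/
def CompsLE (S : Set Pt) (d : ℕ) : Prop :=
  ∀ f : Fin (d + 1) → Pt, (∀ i, f i ∈ S) →
    ∃ i j, i ≠ j ∧ connectedComponentIn S (f i) = connectedComponentIn S (f j)

/-- A Jordan curve: the image of a continuous injective map from the unit
circle to the plane. -/
def IsJordanCurve (J : Set Pt) : Prop :=
  ∃ f : EuclideanSpace ℝ (Fin 2) → Pt,
    ContinuousOn f (Metric.sphere 0 1) ∧ Set.InjOn f (Metric.sphere 0 1) ∧
      J = f '' (Metric.sphere 0 1)

/-- `J` has stabbing number at most `d` (a natural number): every affine line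
meets `J` in at most `d` connected components. -/
def StabLE (J : Set Pt) (d : ℕ) : Prop :=
  ∀ l, IsAffLine l → CompsLE (J ∩ l) d

/-- `J` has stabbing number at most a real number `d`: every affine line meets
`J` in at most `⌊d⌋₊` connected components. -/
def StabLER (J : Set Pt) (d : ℝ) : Prop :=
  ∀ l, IsAffLine l → CompsLE (J ∩ l) ⌊d⌋₊


namespace Stab

/-- Sum of a weight over consecutive pairs of a list. -/
noncomputable def pth (w : Pt → Pt → ℝ) : List Pt → ℝ
  | [] => 0
  | [_] => 0
  | x :: y :: l => w x y + pth w (y :: l)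

open Classical in
/-- Sum of a weight over cyclically consecutive pairs of a list. -/
noncomputable def cyc (w : Pt → Pt → ℝ) (T : List Pt) : ℝ :=
  pth w T + (if h : T ≠ [] then w (T.getLast h) (T.head h) else 0)

open Classical in
/-- Indicator that the boundary of an open half-plane separates two points. -/
noncomputable def cr (α β c : ℝ) (p q : Pt) : ℝ :=
  if (α * p.1 + β * p.2 < c ↔ α * q.1 + β * q.2 < c) then 0 else 1

/-- Euclidean distance. -/
noncomputable def ed (p q : Pt) : ℝ :=
  dist (Complex.equivRealProdCLM.symm p) (Complex.equivRealProdCLM.symm q)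

lemma cr_comm (α β c : ℝ) (p q : Pt) : cr α β c p q = cr α β c q p := by
  unfold cr; simp only [iff_comm]

lemma ed_comm (p q : Pt) : ed p q = ed q p := dist_comm _ _

lemma ed_tri (p q r : Pt) : ed p r ≤ ed p q + ed q r := dist_triangle _ _ _

lemma wbtw_e (p q r : Pt) : Wbtw ℝ (Complex.equivRealProdCLM.symm p)
    (Complex.equivRealProdCLM.symm q) (Complex.equivRealProdCLM.symm r) ↔ Wbtw ℝ p q r := by
  have h := Function.Injective.wbtw_map_iff (R := ℝ) (x := p) (y := q) (z := r)
    (f := Complex.equivRealProdCLM.symm.toLinearEquiv.toLinearMap.toAffineMap)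
    (Complex.equivRealProdCLM.symm.injective)
  simpa using h

lemma ed_eq_iff (p q r : Pt) : ed p q + ed q r = ed p r ↔ Wbtw ℝ p q r := by
  rw [← wbtw_e]; exact dist_add_dist_eq_iff

lemma pth_append (w : Pt → Pt → ℝ) (M N : List Pt) (hM : M ≠ []) (hN : N ≠ []) :
    pth w (M ++ N) = pth w M + w (M.getLast hM) (N.head hN) + pth w N := by
  induction M with
  | nil => exact absurd rfl hM
  | cons x M ih =>
    cases M with
    | nil =>
      cases N with
      | nil => exact absurd rfl hN
      | cons y N => simp [pth]
    | cons y M =>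
      have := ih (by simp)
      simp only [List.cons_append, pth] at this ⊢
      rw [this]
      simp [List.getLast_cons]
      ring

lemma cyc_append (w : Pt → Pt → ℝ) (M N : List Pt) (hM : M ≠ []) (hN : N ≠ []) :
    cyc w (M ++ N) = pth w M + w (M.getLast hM) (N.head hN) + pth w N
      + w (N.getLast hN) (M.head hM) := by
  have h : M ++ N ≠ [] := by simp [hM]
  unfold cyc
  rw [dif_pos h, pth_append w M N hM hN, List.getLast_append_of_ne_nil h hN,
    List.head_append_of_ne_nil hM]

lemma cyc_append_comm (w : Pt → Pt → ℝ) (M N : List Pt) :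
    cyc w (M ++ N) = cyc w (N ++ M) := by
  by_cases hM : M = []
  · simp [hM]
  by_cases hN : N = []
  · simp [hN]
  rw [cyc_append w M N hM hN, cyc_append w N M hN hM]; ring

lemma pth_reverse (w : Pt → Pt → ℝ) (hw : ∀ p q, w p q = w q p) (M : List Pt) :
    pth w M.reverse = pth w M := by
  induction M with
  | nil => rfl
  | cons x M ih =>
    cases M with
    | nil => rfl
    | cons y M =>
      rw [List.reverse_cons, pth_append _ _ _ (by simp) (by simp), ih]
      simp [pth, hw y x]; ring

lemma cyc_two_opt (w : Pt → Pt → ℝ) (hw : ∀ p q, w p q = w q p) (M N : List Pt)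
    (hM : M ≠ []) (hN : N ≠ []) :
    cyc w (M.reverse ++ N) = pth w M + w (M.head hM) (N.head hN) + pth w N
      + w (N.getLast hN) (M.getLast hM) := by
  rw [cyc_append w _ N (by simpa using hM) hN, pth_reverse w hw]
  simp

/-- All lines cross the tour at most `D` times. -/
def CrossLE (D : ℕ) (T : List Pt) : Prop :=
  ∀ α β c : ℝ, (α ≠ 0 ∨ β ≠ 0) → cyc (cr α β c) T ≤ D

/-- A length minimal tour among those with small crossing number. -/
def Good (D : ℕ) (T : List Pt) : Prop :=
  T.Nodup ∧ CrossLE D T ∧ ∀ T' : List Pt, T'.Perm T → CrossLE D T' → cyc ed T ≤ cyc ed T'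

lemma exists_good (D : ℕ) (T : List Pt) (hT : T.Nodup) (hD : CrossLE D T) :
    ∃ T', T'.Perm T ∧ Good D T' := by
  have hfin : {T' : List Pt | T'.Perm T ∧ CrossLE D T'}.Finite := by
    apply (T.permutations.toFinset.finite_toSet).subset
    rintro T' ⟨h, -⟩
    simpa [List.mem_permutations] using h
  obtain ⟨T', ⟨h1, h2⟩, h3⟩ := Set.exists_min_image _ (cyc ed) hfin ⟨T, List.Perm.refl _, hD⟩
  exact ⟨T', h1, h1.nodup_iff.2 hT, h2, fun T'' h4 h5 => h3 T'' ⟨h4.trans h1, h5⟩⟩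

lemma Good.comm {D : ℕ} {M N : List Pt} (h : Good D (M ++ N)) : Good D (N ++ M) := by
  obtain ⟨h1, h2, h3⟩ := h
  refine ⟨List.perm_append_comm.nodup_iff.1 h1, ?_, ?_⟩
  · intro α β c hab; rw [cyc_append_comm]; exact h2 α β c hab
  · intro T' h4 h5
    rw [cyc_append_comm]
    exact h3 T' (h4.trans List.perm_append_comm) h5

lemma half_convex (α β c : ℝ) {p q x : Pt} (h : Wbtw ℝ p x q)
    (hp : α * p.1 + β * p.2 < c) (hq : α * q.1 + β * q.2 < c) : α * x.1 + β * x.2 < c := by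
  obtain ⟨t, ⟨h0, h1⟩, rfl⟩ := h
  simp only [AffineMap.lineMap_apply_module, Prod.fst_add, Prod.smul_fst, Prod.snd_add,
    Prod.smul_snd, smul_eq_mul]
  rcases h0.eq_or_lt with rfl | h0
  · simpa using hp
  · nlinarith

lemma half_convex' (α β c : ℝ) {p q x : Pt} (h : Wbtw ℝ p x q)
    (hp : ¬ α * p.1 + β * p.2 < c) (hq : ¬ α * q.1 + β * q.2 < c) :
    ¬ α * x.1 + β * x.2 < c := by
  obtain ⟨t, ⟨h0, h1⟩, rfl⟩ := h
  simp only [AffineMap.lineMap_apply_module, Prod.fst_add, Prod.smul_fst, Prod.snd_add,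
    Prod.smul_snd, smul_eq_mul]
  push Not at *
  nlinarith

lemma cr_two_opt (α β c : ℝ) {p q r s x : Pt} (h1 : Wbtw ℝ p x q) (h2 : Wbtw ℝ r x s) :
    cr α β c q s + cr α β c p r ≤ cr α β c p q + cr α β c r s := by
  have a1 := half_convex α β c h1
  have a2 := half_convex' α β c h1
  have a3 := half_convex α β c h2
  have a4 := half_convex' α β c h2
  unfold cr
  by_cases e1 : α * p.1 + β * p.2 < c <;> by_cases e2 : α * q.1 + β * q.2 < c <;>
  by_cases e3 : α * r.1 + β * r.2 < c <;> by_cases e4 : α * s.1 + β * s.2 < c <;>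
  simp only [e1, e2, e3, e4, if_true, if_false, iff_true, iff_false, not_true] <;>
    first | (norm_num; done) | (exfalso; tauto)

lemma Good.two_opt {D : ℕ} {M N : List Pt} (h : Good D (M ++ N)) (hM : M ≠ []) (hN : N ≠ [])
    {x : Pt} (h1 : Wbtw ℝ (N.getLast hN) x (M.head hM))
    (h2 : Wbtw ℝ (M.getLast hM) x (N.head hN)) :
    Wbtw ℝ (N.getLast hN) x (M.getLast hM) ∧ Wbtw ℝ (M.head hM) x (N.head hN) := by
  obtain ⟨-, h4, h5⟩ := h
  have h6 := h5 (M.reverse ++ N) (List.Perm.append_right _ (List.reverse_perm M)) (by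
    intro α β c hab
    refine le_trans ?_ (h4 α β c hab)
    rw [cyc_two_opt _ (cr_comm α β c) M N hM hN, cyc_append _ M N hM hN]
    have := cr_two_opt α β c h1 h2
    linarith)
  rw [cyc_two_opt _ ed_comm M N hM hN, cyc_append _ M N hM hN] at h6
  rw [← ed_eq_iff] at h1 h2
  rw [← ed_eq_iff, ← ed_eq_iff]
  have t1 := ed_tri (N.getLast hN) x (M.getLast hM)
  have t2 := ed_tri (M.head hM) x (N.head hN)
  rw [ed_comm (M.getLast hM) x] at h2
  rw [ed_comm x (M.head hM)] at h1
  constructor <;> linarith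

/-- coordinate across direction `v` -/
def fi (v z : Pt) : ℝ := v.1 * z.2 - v.2 * z.1
/-- coordinate along direction `v` -/
def si (v z : Pt) : ℝ := v.1 * z.1 + v.2 * z.2

lemma fi_line (v p q : Pt) (t : ℝ) :
    fi v (AffineMap.lineMap p q t) = (1 - t) * fi v p + t * fi v q := by
  simp [fi, AffineMap.lineMap_apply_module]; ring
lemma si_line (v p q : Pt) (t : ℝ) :
    si v (AffineMap.lineMap p q t) = (1 - t) * si v p + t * si v q := by
  simp [si, AffineMap.lineMap_apply_module]; ring

lemma norm_pos' {v : Pt} (hv : v ≠ 0) : 0 < v.1 ^ 2 + v.2 ^ 2 := by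
  by_contra h
  apply hv
  have h1 : v.1 = 0 := by nlinarith [sq_nonneg v.1, sq_nonneg v.2]
  have h2 : v.2 = 0 := by nlinarith [sq_nonneg v.1, sq_nonneg v.2]
  exact Prod.ext h1 h2

lemma coord_inj {v p q : Pt} (hv : v ≠ 0) (h1 : fi v p = fi v q) (h2 : si v p = si v q) :
    p = q := by
  have h := norm_pos' hv
  unfold fi si at *
  ext
  · apply mul_left_cancel₀ h.ne'
    linear_combination v.1 * h2 - v.2 * h1
  · apply mul_left_cancel₀ h.ne'
    linear_combination v.2 * h2 + v.1 * h1

lemma wbtw_of_coord {v p q x : Pt} {c : ℝ} (hv : v ≠ 0) (hp : fi v p = c) (hq : fi v q = c)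
    (hx : fi v x = c) (h1 : si v p < si v x) (h2 : si v x < si v q) : Wbtw ℝ p x q := by
  have h3 : 0 < si v q - si v p := by linarith
  refine ⟨(si v x - si v p) / (si v q - si v p), ⟨by
    apply div_nonneg <;> linarith, by rw [div_le_one h3]; linarith⟩, ?_⟩
  apply coord_inj hv
  · rw [fi_line, hp, hq, hx]; ring
  · rw [si_line]; field_simp; ring

/-- `x` between `y` and `s`, with `s`, `x` on the line, and `s` before `x`: `y` after `x`. -/
lemma extend_right {v y x s : Pt} {c : ℝ} (h : Wbtw ℝ y x s) (hx : fi v x = c)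
    (hs : fi v s = c) (h1 : si v s < si v x) : fi v y = c ∧ si v x ≤ si v y := by
  obtain ⟨t, ⟨h0, h2⟩, rfl⟩ := h
  rw [fi_line] at hx
  rw [si_line] at h1 ⊢
  have ht : t ≠ 1 := by rintro rfl; simp at h1
  have ht' : 0 < 1 - t := by
    have := lt_of_le_of_ne h2 ht
    linarith
  constructor
  · have : (1 - t) * (fi v y - c) = 0 := by rw [hs] at hx; linarith
    rcases mul_eq_zero.1 this with h | h <;> linarith
  · nlinarith

lemma extend_right_lt {v y x s : Pt} {c : ℝ} (h : Wbtw ℝ y x s) (hv : v ≠ 0) (hyx : y ≠ x)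
    (hx : fi v x = c)
    (hs : fi v s = c) (h1 : si v s < si v x) : fi v y = c ∧ si v x < si v y := by
  obtain ⟨h2, h3⟩ := extend_right h hx hs h1
  refine ⟨h2, lt_of_le_of_ne h3 fun h4 => hyx ?_⟩
  exact coord_inj hv (h2.trans hx.symm) h4.symm

lemma propagate {D : ℕ} {v : Pt} (hv : v ≠ 0) {c : ℝ} (n : ℕ) : ∀ (M N : List Pt)
    (_ : M.length ≤ n) (_ : Good D (M ++ N)) (hM : M ≠ []) (hN : N ≠ []),
    fi v (N.getLast hN) = c → fi v (M.head hM) = c → fi v (M.getLast hM) = c →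
    fi v (N.head hN) = c →
    si v (N.getLast hN) < si v (M.head hM) → si v (N.head hN) < si v (M.getLast hM) →
    si v (N.getLast hN) < si v (M.getLast hM) → si v (N.head hN) < si v (M.head hM) →
    ∀ z ∈ M, fi v z = c := by
  induction n with
  | zero =>
    intro M N hn _ hM
    exact absurd (List.length_eq_zero_iff.1 (Nat.le_zero.1 hn)) hM
  | succ n ih =>
    intro M N hn hG hM hN fp fq fr fs s1 s2 s3 s4
    rcases lt_trichotomy (si v (M.head hM)) (si v (M.getLast hM)) with hlt | heq | hgt
    · -- drop the first element
      obtain ⟨q, M1, rfl⟩ := List.exists_cons_of_ne_nil hM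
      have hM1 : M1 ≠ [] := by rintro rfl; simp at hlt
      have hG' : Good D (M1 ++ (N ++ [q])) := by
        have : Good D (([q] ++ (M1 ++ N))) := by simpa using hG
        simpa using this.comm
      have hN' : N ++ [q] ≠ [] := by simp
      have el : (q :: M1).getLast hM = M1.getLast hM1 := List.getLast_cons hM1
      have eh : (N ++ [q]).head hN' = N.head hN := List.head_append_of_ne_nil hN
      have eg : (N ++ [q]).getLast hN' = q := by simp
      simp only [List.head_cons, el] at *
      have hw : Wbtw ℝ (M1.getLast hM1) q ((N ++ [q]).head hN') := by
        rw [eh]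
        exact (wbtw_of_coord hv fs fr fq s4 hlt).symm
      have h2 := (hG'.two_opt hM1 hN' (x := q) (by rw [eg]; exact wbtw_self_left ℝ _ _) hw).2
      rw [eh] at h2
      have hne : M1.head hM1 ≠ q := by
        intro h
        have := hG.1
        simp only [List.cons_append, List.nodup_cons, List.mem_append] at this
        exact this.1 (Or.inl (h ▸ List.head_mem hM1))
      obtain ⟨h3, h4⟩ := extend_right_lt h2 hv hne fq fs s4
      have := ih M1 (N ++ [q]) (by simpa using hn) hG' hM1 hN' (by rw [eg]; exact fq) h3 fr
        (by rw [eh]; exact fs) (by rw [eg]; exact h4) (by rw [eh]; exact s2)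
        (by rw [eg]; exact hlt) (by rw [eh]; linarith)
      intro z hz
      rcases List.mem_cons.1 hz with rfl | hz
      · exact fq
      · exact this z hz
    · have e : M.head hM = M.getLast hM := coord_inj hv (fq.trans fr.symm) heq
      have hnd : M.Nodup := (List.nodup_append.1 hG.1).1
      cases M with
      | nil => exact absurd rfl hM
      | cons q M1 =>
        by_cases hM1 : M1 = []
        · subst hM1; intro z hz; simp at hz; subst hz; simpa using fq
        · exfalso
          rw [List.getLast_cons hM1, List.head_cons] at e
          exact (List.nodup_cons.1 hnd).1 (e ▸ List.getLast_mem hM1)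
    · -- drop the last element
      obtain ⟨M1, r, rfl⟩ : ∃ M1 r, M = M1 ++ [r] :=
        ⟨M.dropLast, M.getLast hM, (List.dropLast_append_getLast hM).symm⟩
      have hM1 : M1 ≠ [] := by rintro rfl; simp at hgt
      have hG' : Good D (M1 ++ (r :: N)) := by simpa using hG
      have hN' : r :: N ≠ [] := by simp
      have eh : (M1 ++ [r]).head hM = M1.head hM1 := List.head_append_of_ne_nil hM1
      have el : (M1 ++ [r]).getLast hM = r := by simp
      have eg : (r :: N).getLast hN' = N.getLast hN := List.getLast_cons hN
      simp only [eh, el] at *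
      have hw : Wbtw ℝ ((r :: N).getLast hN') r (M1.head hM1) := by
        rw [eg]; exact wbtw_of_coord hv fp fq fr s3 hgt
      have h2 := (hG'.two_opt hM1 hN' (x := r) hw
        (by rw [List.head_cons]; exact wbtw_self_right ℝ _ _)).1
      rw [eg] at h2
      have hne : M1.getLast hM1 ≠ r := by
        intro h
        have h5 := (List.nodup_append.1 hG'.1).2.2 _ (List.getLast_mem hM1) r (by simp)
        exact h5 h
      obtain ⟨h3, h4⟩ := extend_right_lt h2.symm hv hne fr fp s3
      have := ih M1 (r :: N) (by simpa using hn) hG' hM1 hN' (by rw [eg]; exact fp) fq h3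
        (by simpa using fr) (by rw [eg]; exact s1) (by simpa using h4)
        (by rw [eg]; linarith) (by simpa using hgt)
      intro z hz
      rcases List.mem_append.1 hz with hz | hz
      · exact this z hz
      · simp at hz; rw [hz]; exact fr

lemma fi_neg (v z : Pt) : fi (-v) z = - fi v z := by simp [fi]; ring
lemma si_neg (v z : Pt) : si (-v) z = - si v z := by simp [si]; ring

/-- Not all points on a line. -/
def NonCol (T : List Pt) : Prop := ∀ v : Pt, v ≠ 0 → ∀ c : ℝ, ∃ z ∈ T, fi v z ≠ c

lemma simple_aux {D : ℕ} {M N : List Pt} (h : Good D (M ++ N)) (hnc : NonCol (M ++ N))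
    (hM : M ≠ []) (hN : N ≠ [])
    {x : Pt} (h1 : Wbtw ℝ (N.getLast hN) x (M.head hM))
    (h2 : Wbtw ℝ (M.getLast hM) x (N.head hN)) (hp : x ≠ N.getLast hN)
    (hq : x ≠ M.head hM) (hs : x ≠ N.head hN) : False := by
  obtain ⟨h3, h4⟩ := h.two_opt hM hN h1 h2
  set p := N.getLast hN with hpd
  set q := M.head hM with hqd
  set r := M.getLast hM with hrd
  set s := N.head hN with hsd
  have hv : q - p ≠ 0 := by
    intro h0
    have : q = p := sub_eq_zero.1 h0
    rw [this, wbtw_self_iff] at h1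
    exact hp h1
  set v := q - p with hvd
  have e1 : fi v q = fi v p := by simp [fi, hvd]; ring
  have e2 : si v p < si v q := by
    have := norm_pos' hv
    have : si v q - si v p = v.1 ^ 2 + v.2 ^ 2 := by simp [si, hvd]; ring
    linarith
  have e3 : fi v x = fi v p ∧ si v p ≤ si v x ∧ si v x ≤ si v q := by
    obtain ⟨t, ⟨t0, t1⟩, rfl⟩ := h1
    rw [fi_line, si_line, e1]
    refine ⟨by ring, by nlinarith, by nlinarith⟩
  obtain ⟨e3, e4, e5⟩ := e3
  have e4' : si v p < si v x := lt_of_le_of_ne e4 fun h => hp (coord_inj hv e3 h.symm)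
  have e5' : si v x < si v q := lt_of_le_of_ne e5 fun h => hq (coord_inj hv (e3.trans e1.symm) h)
  obtain ⟨e6, e7⟩ := extend_right h3.symm e3 rfl e4'
  have hv' : -v ≠ 0 := neg_ne_zero.2 hv
  obtain ⟨e8, e9⟩ := extend_right_lt (v := -v) (c := - fi v p) h4.symm hv' hs.symm
    (by rw [fi_neg, e3]) (by rw [fi_neg, e1]) (by rw [si_neg, si_neg]; linarith)
  rw [fi_neg] at e8
  rw [si_neg, si_neg] at e9
  have k1 := propagate hv (c := fi v p) M.length M N le_rfl h hM hN rfl e1 e6 (by linarith) e2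
    (by linarith) (by linarith) (by linarith)
  have k2 := propagate hv' (c := - fi v p) N.length N M le_rfl h.comm hN hM
    (by rw [fi_neg, e6]) (by rw [fi_neg]; linarith) (by rw [fi_neg]) (by rw [fi_neg, e1])
    (by rw [si_neg, si_neg]; linarith) (by rw [si_neg, si_neg]; linarith)
    (by rw [si_neg, si_neg]; linarith) (by rw [si_neg, si_neg]; linarith)
  obtain ⟨z, hz, hz'⟩ := hnc v hv (fi v p)
  rcases List.mem_append.1 hz with hz | hz
  · exact hz' (k1 z hz)
  · have := k2 z hz
    rw [fi_neg] at this
    exact hz' (by linarith)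

lemma simple_list {D : ℕ} {M N : List Pt} (h : Good D (M ++ N)) (hnc : NonCol (M ++ N))
    (hM : M ≠ []) (hN : N ≠ [])
    {x : Pt} (h1 : Wbtw ℝ (N.getLast hN) x (M.head hM))
    (h2 : Wbtw ℝ (M.getLast hM) x (N.head hN)) :
    x = M.head hM ∨ x = N.head hN := by
  by_contra hcon
  push Not at hcon
  obtain ⟨hq, hs⟩ := hcon
  by_cases hp : x = N.getLast hN
  · have hr : x ≠ M.getLast hM := by
      intro hr
      exact (List.nodup_append.1 h.1).2.2 _ (List.getLast_mem hM) _ (List.getLast_mem hN)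
        (hr.symm.trans hp)
    exact simple_aux h.comm (fun v hv c => by
      obtain ⟨z, hz, h'⟩ := hnc v hv c
      exact ⟨z, List.mem_append.2 (List.mem_append.1 hz).symm, h'⟩) hN hM h2 h1 hr hs hq
  · exact simple_aux h hnc hM hN h1 h2 hp hq hs


/-- Cyclic indexing into a list. -/
def cx (T : List Pt) (i : ℕ) : Pt := T.getD (i % T.length) 0

lemma cx_lt (T : List Pt) {i : ℕ} (h : i < T.length) : cx T i = T[i] := by
  simp [cx, Nat.mod_eq_of_lt h, h]

lemma cx_len (T : List Pt) : cx T T.length = cx T 0 := by simp [cx]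

lemma cx_period (T : List Pt) (i : ℕ) : cx T (i + T.length) = cx T i := by simp [cx]

lemma pth_eq_sum (w : Pt → Pt → ℝ) (T : List Pt) :
    pth w T = ∑ i ∈ Finset.range (T.length - 1), w (T.getD i 0) (T.getD (i + 1) 0) := by
  induction T with
  | nil => simp [pth]
  | cons x T ih =>
    cases T with
    | nil => simp [pth]
    | cons y T =>
      simp only [pth, ih, List.length_cons, Nat.add_sub_cancel]
      rw [Finset.sum_range_succ', add_comm]
      simp

lemma cyc_eq_sum (w : Pt → Pt → ℝ) (T : List Pt) (hT : T ≠ []) :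
    cyc w T = ∑ i ∈ Finset.range T.length, w (cx T i) (cx T (i + 1)) := by
  have hpos : 0 < T.length := List.length_pos_of_ne_nil hT
  obtain ⟨m, hm⟩ : ∃ m, T.length = m + 1 := ⟨T.length - 1, by omega⟩
  unfold cyc
  rw [pth_eq_sum, dif_pos hT, hm, Finset.sum_range_succ, Nat.add_sub_cancel]
  congr 1
  · apply Finset.sum_congr rfl
    intro i hi
    have hi := Finset.mem_range.1 hi
    rw [cx_lt T (by omega : i < T.length), cx_lt T (by omega : i + 1 < T.length)]
    rw [List.getD_eq_getElem _ _ (by omega), List.getD_eq_getElem _ _ (by omega)]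
  · rw [← hm, cx_len, cx_lt T hpos, cx_lt T (by omega), List.getLast_eq_getElem,
      List.head_eq_getElem]
    simp [hm]

lemma simple_idx_lt {D : ℕ} {T : List Pt} (h : Good D T) (hnc : NonCol T) {i j : ℕ}
    (hij : i < j) (hj : j < T.length) {x : Pt} (h1 : Wbtw ℝ (cx T i) x (cx T (i + 1)))
    (h2 : Wbtw ℝ (cx T j) x (cx T (j + 1))) : x = cx T (i + 1) ∨ x = cx T (j + 1) := by
  set M := (T.drop (i + 1)).take (j - i) with hMd
  set N := T.drop (j + 1) ++ T.take (i + 1) with hNd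
  have e : M ++ N = T.drop (i + 1) ++ T.take (i + 1) := by
    rw [hNd, ← List.append_assoc]
    congr 1
    have : T.drop (j + 1) = (T.drop (i + 1)).drop (j - i) := by
      rw [List.drop_drop]; congr 1; omega
    rw [this, hMd, List.take_append_drop]
  have hG : Good D (M ++ N) := by
    rw [e]; apply Good.comm; rwa [List.take_append_drop]
  have hnc' : NonCol (M ++ N) := by
    intro v hv c
    obtain ⟨z, hz, h'⟩ := hnc v hv c
    refine ⟨z, ?_, h'⟩
    rw [e]
    rw [← List.take_append_drop (i + 1) T] at hz
    exact List.mem_append.2 (List.mem_append.1 hz).symm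
  have lM : M.length = j - i := by
    rw [hMd, List.length_take, List.length_drop]; omega
  have hM : M ≠ [] := by
    intro h; rw [h] at lM; simp at lM; omega
  have htk : T.take (i + 1) ≠ [] := by
    rw [Ne, List.take_eq_nil_iff]
    rintro (h | h)
    · omega
    · simp [h] at hj
  have hN : N ≠ [] := by simp [hNd, htk]
  have a1 : M.head hM = cx T (i + 1) := by
    rw [cx_lt T (by omega), List.head_eq_getElem]; simp [hMd]
  have a2 : M.getLast hM = cx T j := by
    rw [cx_lt T (by omega), List.getLast_eq_getElem]
    simp only [hMd, List.getElem_take, List.getElem_drop]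
    congr 1
    rw [List.length_take, List.length_drop]
    omega
  have a3 : N.getLast hN = cx T i := by
    rw [cx_lt T (by omega), show N.getLast hN = (T.take (i + 1)).getLast htk from
      List.getLast_append_of_ne_nil _ htk, List.getLast_eq_getElem]
    simp only [List.getElem_take]
    congr 1
    simp; omega
  have a4 : N.head hN = cx T (j + 1) := by
    by_cases hj' : j + 1 < T.length
    · rw [cx_lt T hj', List.head_eq_getElem]
      simp only [hNd]
      rw [List.getElem_append_left (by simp; omega)]
      simp
    · have hj'' : j + 1 = T.length := by omega
      have hd : T.drop (j + 1) = [] := by simp; omega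
      rw [hj'', cx_len, cx_lt T (by omega), List.head_eq_getElem]
      simp [hNd, hd]
  have := simple_list hG hnc' hM hN (x := x) (by rwa [a1, a3]) (by rwa [a2, a4])
  rwa [a1, a4] at this

lemma simple_idx {D : ℕ} {T : List Pt} (h : Good D T) (hnc : NonCol T) {i j : ℕ}
    (hij : i ≠ j) (hi : i < T.length) (hj : j < T.length) {x : Pt}
    (h1 : Wbtw ℝ (cx T i) x (cx T (i + 1)))
    (h2 : Wbtw ℝ (cx T j) x (cx T (j + 1))) : x = cx T (i + 1) ∨ x = cx T (j + 1) := by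
  rcases lt_or_gt_of_ne hij with h' | h'
  · exact simple_idx_lt h hnc h' hj h1 h2
  · exact (simple_idx_lt h hnc h' hi h2 h1).symm

/-- The closed polygon with cyclic vertices `P 0, …, P (n-1)`. -/
def poly (n : ℕ) (P : ℕ → Pt) : Set Pt := {x | ∃ i < n, Wbtw ℝ (P i) x (P (i + 1))}

/-- sign class of a point -/
lemma lin_line (α β : ℝ) (p q : Pt) (t : ℝ) :
    α * (AffineMap.lineMap p q t : Pt).1 + β * (AffineMap.lineMap p q t : Pt).2
      = (1 - t) * (α * p.1 + β * p.2) + t * (α * q.1 + β * q.2) := by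
  simp [AffineMap.lineMap_apply_module]; ring

lemma same_comp {S K : Set Pt} (hK : IsPreconnected K) (hKS : K ⊆ S) {x y : Pt} (hx : x ∈ K)
    (hy : y ∈ K) : connectedComponentIn S x = connectedComponentIn S y :=
  connectedComponentIn_eq (hK.subset_connectedComponentIn hx hKS hy)

lemma wbtw_segment_preconn (p q : Pt) : IsPreconnected {x : Pt | Wbtw ℝ p x q} := by
  have : {x : Pt | Wbtw ℝ p x q} = segment ℝ p q := by
    ext x; exact mem_segment_iff_wbtw.symm
  rw [this]; exact (convex_segment p q).isPreconnected

lemma exit_card {n : ℕ} (P : ℕ → Pt) (hper : P n = P 0) (D : ℕ) (α β c : ℝ)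
    (hab : α ≠ 0 ∨ β ≠ 0)
    (hcr : ∀ α β c : ℝ, (α ≠ 0 ∨ β ≠ 0) →
      ∑ i ∈ Finset.range n, cr α β c (P i) (P (i + 1)) ≤ D) (E : Finset ℕ)
    (hE : ∀ i ∈ E, i < n ∧ α * (P (i + 1)).1 + β * (P (i + 1)).2 ≠ c ∧
      ((α * (P i).1 + β * (P i).2 = c) ∨
        (α * (P i).1 + β * (P i).2 < c ∧ c < α * (P (i + 1)).1 + β * (P (i + 1)).2) ∨
        (c < α * (P i).1 + β * (P i).2 ∧ α * (P (i + 1)).1 + β * (P (i + 1)).2 < c))) :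
    E.card ≤ D := by
  classical
  have h1 := hcr α β c hab
  have h2 := hcr (-α) (-β) (-c) (by simpa using hab)
  set F : ℕ → ℝ := fun i => α * (P i).1 + β * (P i).2 with hF
  let z : ℕ → ℝ := fun i => if F i = c then 1 else 0
  have hz : ∑ i ∈ Finset.range n, (z (i + 1) - z i) = 0 := by
    rw [Finset.sum_range_sub]; simp [z, hF, hper]
  have hsub : E ⊆ Finset.range n := fun i hi => Finset.mem_range.2 (hE i hi).1
  have key : ∑ i ∈ Finset.range n, (if i ∈ E then (2 : ℝ) else 0) ≤
      ∑ i ∈ Finset.range n, (cr α β c (P i) (P (i + 1)) +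
        cr (-α) (-β) (-c) (P i) (P (i + 1)) - (z (i + 1) - z i)) := by
    apply Finset.sum_le_sum
    intro i _
    have e1 : cr α β c (P i) (P (i + 1)) = if (F i < c ↔ F (i + 1) < c) then 0 else 1 := rfl
    have e2 : cr (-α) (-β) (-c) (P i) (P (i + 1)) = if (c < F i ↔ c < F (i + 1)) then 0 else 1 := by
      have : ∀ j, -α * (P j).1 + -β * (P j).2 < -c ↔ c < F j := by
        intro j; simp only [hF]; constructor <;> intro h <;> linarith
      unfold cr; simp only [this]
    rw [e1, e2]
    have hEi := hE i
    simp only [z]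
    change i ∈ E → _ ∧ F (i + 1) ≠ c ∧ (F i = c ∨ (F i < c ∧ c < F (i + 1)) ∨
      (c < F i ∧ F (i + 1) < c)) at hEi
    split_ifs <;> first | (norm_num; done) | (exfalso; grind)
  rw [← Finset.sum_filter, Finset.sum_const, Finset.filter_mem_eq_inter,
    Finset.inter_eq_right.2 hsub, Finset.sum_sub_distrib, hz,
    Finset.sum_add_distrib] at key
  simp only [nsmul_eq_mul] at key
  have : (E.card : ℝ) ≤ D := by linarith
  exact_mod_cast this

lemma per_mod {n : ℕ} {P : ℕ → Pt} (hper : ∀ i, P (i + n) = P i) (i : ℕ) :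
    P (i % n) = P i := Function.Periodic.map_mod_nat hper i

lemma per_mod_succ {n : ℕ} {P : ℕ → Pt} (hper : ∀ i, P (i + n) = P i) (i : ℕ) :
    P (i % n + 1) = P (i + 1) := by
  rw [← per_mod hper (i % n + 1), ← per_mod hper (i + 1)]
  congr 1
  simp

lemma edge_mem_poly {n : ℕ} (hn : 0 < n) {P : ℕ → Pt} (hper : ∀ i, P (i + n) = P i) (i : ℕ)
    {x : Pt} (hx : Wbtw ℝ (P i) x (P (i + 1))) : x ∈ poly n P :=
  ⟨i % n, Nat.mod_lt _ hn, by rwa [per_mod hper, per_mod_succ hper]⟩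

lemma on_line {α β c : ℝ} {p q x : Pt} (h : Wbtw ℝ p x q) (hp : α * p.1 + β * p.2 = c)
    (hq : α * q.1 + β * q.2 = c) : α * x.1 + β * x.2 = c := by
  obtain ⟨t, -, rfl⟩ := h
  rw [lin_line, hp, hq]; ring

lemma stab_poly {n : ℕ} (hn : 0 < n) (P : ℕ → Pt) (hper : ∀ i, P (i + n) = P i) (D : ℕ)
    (hcr : ∀ α β c : ℝ, (α ≠ 0 ∨ β ≠ 0) →
      ∑ i ∈ Finset.range n, cr α β c (P i) (P (i + 1)) ≤ D)
    (hnc : ∀ α β c : ℝ, (α ≠ 0 ∨ β ≠ 0) → ∃ i, α * (P i).1 + β * (P i).2 ≠ c) :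
    StabLE (poly n P) D := by
  classical
  rintro l ⟨α, β, c, hab, rfl⟩ f hf
  set S : Set Pt := poly n P ∩ {p : Pt | α * p.1 + β * p.2 = c} with hS
  let Ex : ℕ → Prop := fun i => i < n ∧ α * (P (i + 1)).1 + β * (P (i + 1)).2 ≠ c ∧
      ((α * (P i).1 + β * (P i).2 = c) ∨
        (α * (P i).1 + β * (P i).2 < c ∧ c < α * (P (i + 1)).1 + β * (P (i + 1)).2) ∨
        (c < α * (P i).1 + β * (P i).2 ∧ α * (P (i + 1)).1 + β * (P (i + 1)).2 < c))
  have link : ∀ (i : ℕ) (z : Pt), Wbtw ℝ (P i) z (P (i + 1)) → α * z.1 + β * z.2 = c →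
      α * (P (i + 1)).1 + β * (P (i + 1)).2 = c →
      connectedComponentIn S z = connectedComponentIn S (P (i + 1)) := by
    intro i z hz h1 h2
    refine same_comp (wbtw_segment_preconn z (P (i + 1))) ?_ (wbtw_self_left ℝ _ _)
      (wbtw_self_right ℝ _ _)
    intro x hx
    exact ⟨edge_mem_poly hn hper i (hz.trans_right hx), on_line hx h1 h2⟩
  have walk : ∀ k i : ℕ, α * (P i).1 + β * (P i).2 = c →
      α * (P (i + k)).1 + β * (P (i + k)).2 ≠ c →
      ∃ e, Ex e ∧ α * (P e).1 + β * (P e).2 = c ∧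
        connectedComponentIn S (P i) = connectedComponentIn S (P e) := by
    intro k
    induction k with
    | zero => intro i h1 h2; exact absurd h1 h2
    | succ k ih =>
      intro i h1 h2
      by_cases h3 : α * (P (i + 1)).1 + β * (P (i + 1)).2 = c
      · obtain ⟨e, he1, he2, he3⟩ := ih (i + 1) h3 (by rwa [add_assoc, add_comm 1 k])
        exact ⟨e, he1, he2, (link i (P i) (wbtw_self_left ℝ _ _) h1 h3).trans he3⟩
      · refine ⟨i % n, ⟨Nat.mod_lt _ hn, ?_, Or.inl ?_⟩, ?_, ?_⟩
        · rwa [per_mod_succ hper]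
        · rwa [per_mod hper]
        · rwa [per_mod hper]
        · rw [per_mod hper]
  have main : ∀ z ∈ S, ∃ e, Ex e ∧ ∃ y, Wbtw ℝ (P e) y (P (e + 1)) ∧ α * y.1 + β * y.2 = c ∧
      connectedComponentIn S z = connectedComponentIn S y := by
    rintro z ⟨⟨i, hi, hz⟩, hzc⟩
    change α * z.1 + β * z.2 = c at hzc
    by_cases h3 : α * (P (i + 1)).1 + β * (P (i + 1)).2 = c
    · obtain ⟨i0, hi0⟩ := hnc α β c hab
      have hk : P (i + 1 + (i0 + (i + 1) * n - (i + 1))) = P i0 := by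
        have : i + 1 + (i0 + (i + 1) * n - (i + 1)) = i0 + (i + 1) * n := by
          have := Nat.le_mul_of_pos_right (i + 1) hn
          omega
        rw [this, ← per_mod hper (i0 + (i + 1) * n), ← per_mod hper i0]
        simp
      obtain ⟨e, he1, he2, he3⟩ := walk (i0 + (i + 1) * n - (i + 1)) (i + 1) h3 (by rwa [hk])
      exact ⟨e, he1, P e, wbtw_self_left ℝ _ _, he2, (link i z hz hzc h3).trans he3⟩
    · refine ⟨i, ⟨hi, h3, ?_⟩, z, hz, hzc, rfl⟩
      obtain ⟨t, ⟨t0, t1⟩, rfl⟩ := hz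
      rw [lin_line] at hzc
      rcases lt_trichotomy (α * (P i).1 + β * (P i).2) c with h | h | h
      · refine Or.inr (Or.inl ⟨h, ?_⟩)
        by_contra h5
        have h6 := lt_of_le_of_ne (not_lt.1 h5) h3
        rcases t0.eq_or_lt with h7 | h7 <;> nlinarith
      · exact Or.inl h
      · refine Or.inr (Or.inr ⟨h, ?_⟩)
        by_contra h5
        have h6 := lt_of_le_of_ne (not_lt.1 h5) (Ne.symm h3)
        rcases t0.eq_or_lt with h7 | h7 <;> nlinarith
  choose e he y hy1 hy2 hy3 using fun i => main (f i) (hf i)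
  let E : Finset ℕ := (Finset.range n).filter Ex
  have hcard : E.card ≤ D := by
    apply exit_card P (by simpa using hper 0) D α β c hab hcr E
    intro i hi
    exact (Finset.mem_filter.1 hi).2
  obtain ⟨i, -, j, -, hij, heq⟩ := Finset.exists_ne_map_eq_of_card_lt_of_maps_to
    (s := (Finset.univ : Finset (Fin (D + 1)))) (t := E) (f := e) (by simp; omega)
    (fun i _ => Finset.mem_filter.2 ⟨Finset.mem_range.2 (he i).1, he i⟩)
  refine ⟨i, j, hij, ?_⟩
  rw [hy3 i, hy3 j]
  congr 1
  have h1 := hy1 i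
  have h2 := hy1 j
  have h3 := hy2 i
  have h4 := hy2 j
  rw [← heq] at h2
  obtain ⟨-, g1, g2⟩ := he i
  obtain ⟨t, -, ht⟩ := h1
  obtain ⟨t', -, ht'⟩ := h2
  rw [← ht, lin_line] at h3
  rw [← ht', lin_line] at h4
  have hne : α * (P (e i)).1 + β * (P (e i)).2 ≠
      α * (P (e i + 1)).1 + β * (P (e i + 1)).2 := by
    rcases g2 with g | g | g
    · rw [g]; exact g1.symm
    · exact (g.1.trans g.2).ne
    · exact (g.2.trans g.1).ne'
  have : t = t' := by
    have h5 : (t - t') * ((α * (P (e i)).1 + β * (P (e i)).2) -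
      (α * (P (e i + 1)).1 + β * (P (e i + 1)).2)) = 0 := by linear_combination h4 - h3
    rcases mul_eq_zero.1 h5 with h | h
    · linarith
    · exact absurd (sub_eq_zero.1 h) hne
  rw [← ht, ← ht', this]

/-- The unit sphere to `Circle`. -/
noncomputable def toCircle : (Metric.sphere (0 : EuclideanSpace ℝ (Fin 2)) 1) ≃ₜ Circle where
  toFun x := ⟨Complex.orthonormalBasisOneI.repr.symm x.1, by
    have := x.2
    simp only [mem_sphere_zero_iff_norm] at this
    exact mem_sphere_zero_iff_norm.2 (by rw [LinearIsometryEquiv.norm_map, this])⟩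
  invFun z := ⟨Complex.orthonormalBasisOneI.repr z.1, by
    rw [mem_sphere_zero_iff_norm, LinearIsometryEquiv.norm_map]; exact Circle.norm_coe z⟩
  left_inv x := Subtype.ext (LinearIsometryEquiv.apply_symm_apply _ _)
  right_inv z := Subtype.ext (LinearIsometryEquiv.symm_apply_apply _ _)
  continuous_toFun := by
    apply Continuous.subtype_mk
    exact Complex.orthonormalBasisOneI.repr.symm.continuous.comp continuous_subtype_val
  continuous_invFun := by
    apply Continuous.subtype_mk
    exact Complex.orthonormalBasisOneI.repr.continuous.comp continuous_subtype_val

lemma jordan_of_param {L : ℝ} (hL : 0 < L) (g : ℝ → Pt) (hc : ContinuousOn g (Set.Icc 0 L))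
    (h0 : g 0 = g L) (hinj : Set.InjOn g (Set.Ico 0 L)) : IsJordanCurve (g '' Set.Ico 0 L) := by
  classical
  have : Fact (0 < L) := ⟨hL⟩
  let G : AddCircle L → Pt := AddCircle.liftIco L 0 g
  have hG : Continuous G := AddCircle.liftIco_continuous (by simpa using h0) (by simpa using hc)
  have hGv : ∀ t ∈ Set.Ico 0 L, G (t : AddCircle L) = g t := fun t ht =>
    AddCircle.liftIco_coe_apply (by simpa using ht)
  have hsurj : ∀ z : AddCircle L, ∃ t ∈ Set.Ico 0 L, (t : AddCircle L) = z := by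
    intro z
    have := AddCircle.coe_image_Ico_eq L 0
    have hz : z ∈ ((↑) : ℝ → AddCircle L) '' Set.Ico 0 (0 + L) := by rw [this]; trivial
    simpa using hz
  let h : (Metric.sphere (0 : EuclideanSpace ℝ (Fin 2)) 1) ≃ₜ AddCircle L :=
    toCircle.trans (AddCircle.homeomorphCircle hL.ne').symm
  let f : EuclideanSpace ℝ (Fin 2) → Pt := fun x =>
    if hx : x ∈ Metric.sphere (0 : EuclideanSpace ℝ (Fin 2)) 1 then G (h ⟨x, hx⟩) else 0
  have hf : ∀ x : Metric.sphere (0 : EuclideanSpace ℝ (Fin 2)) 1, f x = G (h x) := by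
    intro x; simp only [f]; rw [dif_pos x.2]
  refine ⟨f, ?_, ?_, ?_⟩
  · rw [continuousOn_iff_continuous_domRestrict]
    have : (Metric.sphere (0 : EuclideanSpace ℝ (Fin 2)) 1).domRestrict f = G ∘ h := by
      ext1 x; exact hf x
    rw [this]; exact hG.comp h.continuous
  · intro x hx y hy hxy
    have e1 := hf ⟨x, hx⟩
    have e2 := hf ⟨y, hy⟩
    simp only at e1 e2
    rw [e1, e2] at hxy
    obtain ⟨t, ht, ht'⟩ := hsurj (h ⟨x, hx⟩)
    obtain ⟨s, hs, hs'⟩ := hsurj (h ⟨y, hy⟩)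
    rw [← ht', ← hs', hGv t ht, hGv s hs] at hxy
    have := hinj ht hs hxy
    rw [this, hs'] at ht'
    simpa using ht'.symm
  · ext z
    constructor
    · rintro ⟨t, ht, rfl⟩
      refine ⟨(h.symm (t : AddCircle L)).1, (h.symm (t : AddCircle L)).2, ?_⟩
      rw [hf, h.apply_symm_apply, hGv t ht]
    · rintro ⟨x, hx, rfl⟩
      obtain ⟨t, ht, ht'⟩ := hsurj (h ⟨x, hx⟩)
      refine ⟨t, ht, ?_⟩
      have e1 := hf ⟨x, hx⟩
      simp only at e1
      rw [e1, ← ht', hGv t ht]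

lemma param_of_jordan {J : Set Pt} (hJ : IsJordanCurve J) : ∃ g : ℝ → Pt, Continuous g ∧
    g 0 = g 1 ∧ Set.InjOn g (Set.Ico 0 1) ∧ J = g '' Set.Ico 0 1 := by
  obtain ⟨f, hc, hi, rfl⟩ := hJ
  have : Fact ((0 : ℝ) < 1) := ⟨one_pos⟩
  let h : (Metric.sphere (0 : EuclideanSpace ℝ (Fin 2)) 1) ≃ₜ AddCircle (1 : ℝ) :=
    toCircle.trans (AddCircle.homeomorphCircle one_ne_zero).symm
  refine ⟨fun t => f (h.symm (t : AddCircle (1 : ℝ))).1, ?_, ?_, ?_, ?_⟩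
  · have := continuousOn_iff_continuous_domRestrict.1 hc
    exact (this.comp h.symm.continuous).comp (AddCircle.continuous_mk' 1)
  · have : ((1 : ℝ) : AddCircle (1 : ℝ)) = ((0 : ℝ) : AddCircle (1 : ℝ)) := by
      rw [AddCircle.coe_zero]; exact AddCircle.coe_period (1 : ℝ)
    simp only [this]
  · intro s hs t ht hst
    have := hi (h.symm (s : AddCircle (1 : ℝ))).2 (h.symm (t : AddCircle (1 : ℝ))).2 hst
    have := h.symm.injective (Subtype.ext this)
    exact (AddCircle.coe_eq_coe_iff_of_mem_Ico (a := 0) (by simpa using hs)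
      (by simpa using ht)).1 this
  · ext z
    constructor
    · rintro ⟨x, hx, rfl⟩
      have := AddCircle.coe_image_Ico_eq (1 : ℝ) 0
      have hz : h ⟨x, hx⟩ ∈ ((↑) : ℝ → AddCircle (1 : ℝ)) '' Set.Ico 0 (0 + 1) := by
        rw [this]; trivial
      obtain ⟨t, ht, ht'⟩ := hz
      refine ⟨t, by simpa using ht, ?_⟩
      simp [ht']
    · rintro ⟨t, ht, rfl⟩
      exact ⟨_, (h.symm (t : AddCircle (1 : ℝ))).2, rfl⟩

/-- Piecewise linear parametrization. -/
noncomputable def pl (P : ℕ → Pt) (t : ℝ) : Pt :=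
  AffineMap.lineMap (P ⌊t⌋₊) (P (⌊t⌋₊ + 1)) (t - ⌊t⌋₊)

lemma pl_eq (P : ℕ → Pt) (k : ℕ) {t : ℝ} (h1 : (k : ℝ) ≤ t) (h2 : t ≤ k + 1) :
    pl P t = AffineMap.lineMap (P k) (P (k + 1)) (t - k) := by
  rcases h2.eq_or_lt with rfl | h2
  · have : ⌊(k : ℝ) + 1⌋₊ = k + 1 := by exact_mod_cast Nat.floor_natCast (k + 1)
    unfold pl
    rw [this]
    simp
  · have : ⌊t⌋₊ = k := (Nat.floor_eq_iff (le_trans (Nat.cast_nonneg k) h1)).2 ⟨h1, h2⟩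
    unfold pl
    rw [this]

lemma pl_cont (P : ℕ → Pt) (m : ℕ) : ContinuousOn (pl P) (Set.Icc 0 (m : ℝ)) := by
  induction m with
  | zero => simp
  | succ m ih =>
    have : Set.Icc (0 : ℝ) ((m + 1 : ℕ) : ℝ) = Set.Icc 0 (m : ℝ) ∪ Set.Icc (m : ℝ) (m + 1) := by
      rw [Set.Icc_union_Icc_eq_Icc (Nat.cast_nonneg m) (by linarith)]; push_cast; rfl
    rw [this]
    refine ih.union_of_isClosed ?_ isClosed_Icc isClosed_Icc
    have hc : Continuous fun t : ℝ => (AffineMap.lineMap (P m) (P (m + 1)) (t - m) : Pt) := by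
      simp only [AffineMap.lineMap_apply_module]; fun_prop
    exact hc.continuousOn.congr fun t ht => pl_eq P m ht.1 ht.2

lemma jordan_poly {n : ℕ} (hn : 0 < n) (P : ℕ → Pt) (hper : P n = P 0)
    (hne : ∀ i < n, P i ≠ P (i + 1))
    (hs : ∀ i j, i ≠ j → i < n → j < n → ∀ x, Wbtw ℝ (P i) x (P (i + 1)) →
      Wbtw ℝ (P j) x (P (j + 1)) → x = P (i + 1) ∨ x = P (j + 1)) :
    IsJordanCurve (poly n P) := by
  have e : poly n P = pl P '' Set.Ico 0 (n : ℝ) := by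
    ext x
    constructor
    · rintro ⟨i, hi, t, ⟨t0, t1⟩, rfl⟩
      have hi' : (i : ℝ) + 1 ≤ n := by exact_mod_cast hi
      have h0 : (0 : ℝ) ≤ i := Nat.cast_nonneg i
      by_cases h : (i : ℝ) + t < n
      · refine ⟨i + t, ⟨by linarith, h⟩, ?_⟩
        rw [pl_eq P i (by linarith) (by linarith)]; simp
      · have h1 : t = 1 := by linarith
        have h2 : i + 1 = n := by
          have : (i : ℝ) + 1 = n := by linarith
          exact_mod_cast this
        refine ⟨0, ⟨le_rfl, by exact_mod_cast hn⟩, ?_⟩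
        have := pl_eq P 0 (t := 0) (by simp) (by simp)
        rw [this, h1, h2, hper]; simp
    · rintro ⟨t, ⟨t0, t1⟩, rfl⟩
      have h1 := Nat.floor_le t0
      have h2 := (Nat.lt_floor_add_one t).le
      refine ⟨⌊t⌋₊, (Nat.floor_lt t0).2 t1, t - ⌊t⌋₊, ⟨by linarith, by linarith⟩, rfl⟩
  rw [e]
  apply jordan_of_param (by exact_mod_cast hn) _ (pl_cont P n)
  · rw [pl_eq P 0 (by simp) (by simp), pl_eq P n (by simp) (by simp)]; simp [hper]
  · have key : ∀ i < n, ∀ t : ℝ, t < 1 →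
        (AffineMap.lineMap (P i) (P (i + 1)) t : Pt) ≠ P (i + 1) := by
      intro i hi t ht h
      have h' : (AffineMap.lineMap (P i) (P (i + 1)) t : Pt) =
        AffineMap.lineMap (P i) (P (i + 1)) (1 : ℝ) := by simpa using h
      exact ht.ne (AffineMap.lineMap_injective ℝ (hne i hi) h')
    rintro t ⟨t0, t1⟩ s ⟨s0, s1⟩ hts
    have a1 := Nat.floor_le t0
    have a2 := Nat.lt_floor_add_one t
    have a3 := (Nat.floor_lt t0).2 t1
    have b1 := Nat.floor_le s0
    have b2 := Nat.lt_floor_add_one s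
    have b3 := (Nat.floor_lt s0).2 s1
    unfold pl at hts
    by_cases hfl : ⌊t⌋₊ = ⌊s⌋₊
    · rw [← hfl] at hts
      have := AffineMap.lineMap_injective ℝ (hne _ a3) hts
      linarith
    · exfalso
      rcases hs _ _ hfl a3 b3 _ ⟨t - ⌊t⌋₊, ⟨by linarith, by linarith⟩, rfl⟩
        ⟨s - ⌊s⌋₊, ⟨by linarith, by linarith⟩, hts.symm⟩ with h | h
      · exact key _ a3 _ (by linarith) h
      · rw [hts] at h
        exact key _ b3 _ (by linarith) h

lemma assemble {D : ℕ} {T : List Pt} (hT : T.Nodup) (hnc : NonCol T) (hD : CrossLE D T) :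
    ∃ T' : List Pt, T'.Perm T ∧ IsJordanCurve (poly T'.length (cx T')) ∧
      StabLE (poly T'.length (cx T')) D := by
  obtain ⟨T', hp, hG⟩ := exists_good D T hT hD
  have hnc' : NonCol T' := fun v hv c => by
    obtain ⟨z, hz, h⟩ := hnc v hv c
    exact ⟨z, hp.mem_iff.2 hz, h⟩
  have hne : T' ≠ [] := by
    rintro rfl
    obtain ⟨z, hz, -⟩ := hnc' (1, 0) (by simp) 0
    simp at hz
  have hpos : 0 < T'.length := List.length_pos_of_ne_nil hne
  have h2 : 1 < T'.length := by
    by_contra h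
    have h1 : T'.length = 1 := by omega
    obtain ⟨x, hx⟩ := List.length_eq_one_iff.1 h1
    obtain ⟨z, hz, h'⟩ := hnc' (1, 0) (by simp) (fi (1, 0) x)
    rw [hx] at hz
    simp at hz
    exact h' (by rw [hz])
  refine ⟨T', hp, jordan_poly hpos _ (cx_len T') ?_ ?_, stab_poly hpos _ (cx_period T') D ?_ ?_⟩
  · intro i hi h
    have hmod : (i + 1) % T'.length < T'.length := Nat.mod_lt _ hpos
    have e : cx T' (i + 1) = T'[(i + 1) % T'.length] := by
      rw [← cx_lt T' hmod]; simp [cx]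
    rw [cx_lt T' hi, e] at h
    have := (List.Nodup.getElem_inj_iff hG.1).1 h
    by_cases h3 : i + 1 < T'.length
    · rw [Nat.mod_eq_of_lt h3] at this; omega
    · have h4 : i + 1 = T'.length := by omega
      rw [h4, Nat.mod_self] at this; omega
  · intro i j hij hi hj x h1 h2
    exact simple_idx hG hnc' hij hi hj h1 h2
  · intro α β c hab
    rw [← cyc_eq_sum _ _ hne]
    exact hG.2.1 α β c hab
  · intro α β c hab
    obtain ⟨z, hz, h⟩ := hnc' (β, -α) (by
      intro h
      have h3 := congrArg Prod.fst h
      have h4 := congrArg Prod.snd h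
      simp at h3 h4
      tauto) c
    obtain ⟨i, hi, rfl⟩ := List.getElem_of_mem hz
    refine ⟨i, ?_⟩
    rw [cx_lt T' hi]
    intro h5
    apply h
    simp only [fi]
    linarith

lemma sep_circle {g : ℝ → Pt} (hc : Continuous g) (h01 : g 0 = g 1)
    (hi : Set.InjOn g (Set.Ico 0 1)) {x y s s' : ℝ} (hx : 0 ≤ x) (hy : y < 1)
    (hs : s ∈ Set.Ioo x y) (hs' : s' ∈ Set.Ico (0 : ℝ) 1) (hss : s' ≤ x ∨ y ≤ s')
    {C : Set Pt} (hC : IsPreconnected C) (hCJ : C ⊆ g '' Set.Ico 0 1) (m1 : g s ∈ C)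
    (m2 : g s' ∈ C) : g x ∈ C ∨ g y ∈ C := by
  have hxy : x < y := hs.1.trans hs.2
  have c1 : IsClosed (g '' Set.Icc x y) := (isCompact_Icc.image hc).isClosed
  have c2 : IsClosed (g '' (Set.Icc 0 x ∪ Set.Icc y 1)) :=
    ((isCompact_Icc.union isCompact_Icc).image hc).isClosed
  have hcov : C ⊆ g '' Set.Icc x y ∪ g '' (Set.Icc 0 x ∪ Set.Icc y 1) := by
    intro z hz
    obtain ⟨t, ⟨t0, t1⟩, rfl⟩ := hCJ hz
    rcases le_total t x with h | h
    · exact Or.inr ⟨t, Or.inl ⟨t0, h⟩, rfl⟩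
    rcases le_total t y with h' | h'
    · exact Or.inl ⟨t, ⟨h, h'⟩, rfl⟩
    · exact Or.inr ⟨t, Or.inr ⟨h', t1.le⟩, rfl⟩
  obtain ⟨z, hzC, ⟨t, ⟨t0, t1⟩, rfl⟩, u, hu, hut⟩ := isPreconnected_closed_iff.1 hC _ _ c1 c2 hcov
    ⟨g s, m1, s, ⟨hs.1.le, hs.2.le⟩, rfl⟩
    ⟨g s', m2, s', hss.imp (fun h => ⟨hs'.1, h⟩) (fun h => ⟨h, hs'.2.le⟩), rfl⟩
  have ht : t ∈ Set.Ico (0 : ℝ) 1 := ⟨hx.trans t0, by linarith⟩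
  have h3 : ∀ u ∈ Set.Ico (0 : ℝ) 1, (u ≤ x ∨ y ≤ u) → g u = g t → g x ∈ C ∨ g y ∈ C := by
    intro u hu h hut
    have := hi hu ht hut
    subst this
    rcases h with h | h
    · left; rw [le_antisymm t0 h]; exact hzC
    · right; rw [le_antisymm h t1]; exact hzC
  rcases hu with hu | hu
  · exact h3 u ⟨hu.1, by linarith [hu.2]⟩ (Or.inl hu.2) hut
  · rcases hu.2.eq_or_lt with rfl | h
    · exact h3 0 ⟨le_rfl, one_pos⟩ (Or.inl hx) (h01.trans hut)
    · exact h3 u ⟨by linarith [hu.1], h⟩ (Or.inr hu.1) hut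

lemma list_of_curve (A : Finset Pt) (a : ℕ) (J : Set Pt) (hJ : IsJordanCurve J)
    (hst : StabLE J a) (hAJ : (↑A : Set Pt) ⊆ J) :
    ∃ L : List Pt, L.Nodup ∧ (∀ z, z ∈ L ↔ z ∈ A) ∧
      ∀ α β c : ℝ, (α ≠ 0 ∨ β ≠ 0) → pth (cr α β c) L ≤ a := by
  classical
  obtain ⟨g, hc, h01, hi, rfl⟩ := param_of_jordan hJ
  have : ∀ p : Pt, ∃ t, p ∈ A → t ∈ Set.Ico (0 : ℝ) 1 ∧ g t = p := by
    intro p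
    by_cases hp : p ∈ A
    · obtain ⟨t, h1, h2⟩ := hAJ hp
      exact ⟨t, fun _ => ⟨h1, h2⟩⟩
    · exact ⟨0, fun h => absurd h hp⟩
  choose τ hτ using this
  set S : List ℝ := (A.image τ).sort (· ≤ ·) with hS
  have hSm : ∀ t, t ∈ S ↔ ∃ p ∈ A, τ p = t := by
    intro t; simp [hS]
  have hSI : ∀ t ∈ S, t ∈ Set.Ico (0 : ℝ) 1 := by
    intro t ht
    obtain ⟨p, hp, rfl⟩ := (hSm t).1 ht
    exact (hτ p hp).1
  have hgA : ∀ t ∈ S, g t ∈ A := by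
    intro t ht
    obtain ⟨p, hp, rfl⟩ := (hSm t).1 ht
    rw [(hτ p hp).2]; exact hp
  have hmono : ∀ i j (hi : i < S.length) (hj : j < S.length), i < j → S[i] < S[j] := by
    intro i j hi hj hij
    exact (Finset.sortedLT_sort (A.image τ)).strictMono_get (a := ⟨i, hi⟩) (b := ⟨j, hj⟩) hij
  refine ⟨S.map g, ?_, ?_, ?_⟩
  · refine List.Nodup.map_on ?_ (Finset.sort_nodup _ _)
    intro x hx y hy hxy
    exact hi (hSI x hx) (hSI y hy) hxy
  · intro z
    rw [List.mem_map]
    constructor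
    · rintro ⟨t, ht, rfl⟩; exact hgA t ht
    · intro hz
      exact ⟨τ z, (hSm _).2 ⟨z, hz, rfl⟩, (hτ z hz).2⟩
  · intro α β c hab
    let F : Pt → ℝ := fun p => α * p.1 + β * p.2
    have hF : Continuous F := by fun_prop
    obtain ⟨c', hc1, hc2⟩ : ∃ c' < c, ∀ p ∈ A, F p < c → F p < c' := by
      have h1 : ∀ᶠ c' in nhdsWithin c (Set.Iio c), ∀ p ∈ A, F p < c → F p < c' := by
        rw [Filter.eventually_all_finset]
        intro p _
        by_cases h : F p < c
        · filter_upwards [Ioo_mem_nhdsLT h] with x hx _ using hx.1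
        · exact Filter.Eventually.of_forall fun _ h' => absurd h' h
      obtain ⟨c', h2, h3⟩ := (h1.and self_mem_nhdsWithin).exists
      exact ⟨c', h3, h2⟩
    have hiff : ∀ p ∈ A, (F p < c ↔ F p < c') := fun p hp =>
      ⟨hc2 p hp, fun h => h.trans hc1⟩
    have hne : ∀ p ∈ A, F p ≠ c' := by
      intro p hp h
      have := hc2 p hp (h ▸ hc1)
      exact this.ne h
    rw [pth_eq_sum, List.length_map]
    have hgd : ∀ i (h : i < S.length), (S.map g).getD i 0 = g S[i] := by
      intro i h
      rw [List.getD_eq_getElem _ _ (by simpa using h)]; simp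
    set K : Finset ℕ := (Finset.range (S.length - 1)).filter fun i =>
      ¬ (F ((S.map g).getD i 0) < c ↔ F ((S.map g).getD (i + 1) 0) < c) with hK
    have hsum : ∑ i ∈ Finset.range (S.length - 1),
        cr α β c ((S.map g).getD i 0) ((S.map g).getD (i + 1) 0) = K.card := by
      rw [hK, Finset.card_filter]
      push_cast
      apply Finset.sum_congr rfl
      intro i _
      unfold cr
      simp only [F, ite_not]
    rw [hsum]
    by_contra hcon
    have hcard : a + 1 ≤ K.card := by
      have : a < K.card := by
        have := not_le.1 hcon
        exact_mod_cast this
      omega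
    obtain ⟨K', hK', hKc⟩ := Finset.exists_subset_card_eq hcard
    have hcross : ∀ i ∈ K, ∃ h : i + 1 < S.length, ∃ s ∈ Set.Ioo S[i] S[i + 1],
        F (g s) = c' := by
      intro i hiK
      obtain ⟨h1, h2⟩ := Finset.mem_filter.1 hiK
      have h3 := Finset.mem_range.1 h1
      have h4 : i + 1 < S.length := by omega
      refine ⟨h4, ?_⟩
      have h5 : i < S.length := by omega
      rw [hgd i h5, hgd (i + 1) h4, hiff _ (hgA _ (List.getElem_mem h5)),
        hiff _ (hgA _ (List.getElem_mem h4))] at h2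
      have h6 := hmono i (i + 1) h5 h4 (by omega)
      have n1 := hne _ (hgA _ (List.getElem_mem h5))
      have n2 := hne _ (hgA _ (List.getElem_mem h4))
      have hcon : ContinuousOn (fun s => F (g s)) (Set.Icc S[i] S[i + 1]) :=
        (hF.comp hc).continuousOn
      have : ∃ s ∈ Set.Icc S[i] S[i + 1], F (g s) = c' := by
        by_cases h7 : F (g S[i]) < c'
        · have h8 : ¬ F (g S[i + 1]) < c' := by tauto
          obtain ⟨s, hs, hs'⟩ := intermediate_value_Icc h6.le hcon
            (show c' ∈ Set.Icc _ _ from ⟨h7.le, not_lt.1 h8⟩)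
          exact ⟨s, hs, hs'⟩
        · have h8 : F (g S[i + 1]) < c' := by tauto
          obtain ⟨s, hs, hs'⟩ := intermediate_value_Icc' h6.le hcon
            (show c' ∈ Set.Icc _ _ from ⟨h8.le, not_lt.1 h7⟩)
          exact ⟨s, hs, hs'⟩
      obtain ⟨s, hs, hs'⟩ := this
      refine ⟨s, ⟨lt_of_le_of_ne hs.1 ?_, lt_of_le_of_ne hs.2 ?_⟩, hs'⟩
      · intro h; rw [← h] at hs'; exact n1 hs'
      · intro h; rw [h] at hs'; exact n2 hs'
    let κ := K'.orderEmbOfFin hKc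
    have hκ : ∀ i, κ i ∈ K := fun i => hK' (Finset.orderEmbOfFin_mem K' hKc i)
    choose hl s hsI hsF using fun i => hcross (κ i) (hκ i)
    have hs01 : ∀ i, s i ∈ Set.Ico (0 : ℝ) 1 := by
      intro i
      have h1 := hSI _ (List.getElem_mem (hl i))
      have h2 := hSI _ (List.getElem_mem (show κ i < S.length by have := hl i; omega))
      exact ⟨by linarith [h2.1, (hsI i).1], by linarith [h1.2, (hsI i).2]⟩
    obtain ⟨i, j, hij, hcomp⟩ := hst {p : Pt | α * p.1 + β * p.2 = c'} ⟨α, β, c', hab, rfl⟩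
      (fun i => g (s i)) (fun i => ⟨⟨s i, hs01 i, rfl⟩, hsF i⟩)
    have hκne : κ i ≠ κ j := fun h => hij (κ.injective h)
    have hlt : κ i < S.length := by have := hl i; omega
    have hltj : κ j < S.length := by have := hl j; omega
    have hss : s j ≤ S[κ i] ∨ S[κ i + 1]'(hl i) ≤ s j := by
      rcases lt_or_gt_of_ne hκne with h | h
      · right
        refine le_trans ?_ (hsI j).1.le
        rcases (Nat.succ_le_of_lt h).eq_or_lt with h' | h'
        · simp only [← h', Nat.succ_eq_add_one]; exact le_rfl
        · exact (hmono _ _ (hl i) hltj h').le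
      · left
        refine le_trans (hsI j).2.le ?_
        rcases (Nat.succ_le_of_lt h).eq_or_lt with h' | h'
        · simp only [← h', Nat.succ_eq_add_one]; exact le_rfl
        · exact (hmono _ _ (hl j) hlt h').le
    set C := connectedComponentIn (g '' Set.Ico 0 1 ∩ {p : Pt | α * p.1 + β * p.2 = c'}) (g (s i))
      with hC
    have hCsub : C ⊆ g '' Set.Ico 0 1 ∩ {p : Pt | α * p.1 + β * p.2 = c'} :=
      connectedComponentIn_subset _ _
    have m1 : g (s i) ∈ C := mem_connectedComponentIn ⟨⟨s i, hs01 i, rfl⟩, hsF i⟩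
    have m2 : g (s j) ∈ C := by
      rw [hcomp]; exact mem_connectedComponentIn ⟨⟨s j, hs01 j, rfl⟩, hsF j⟩
    rcases sep_circle hc h01 hi (hSI _ (List.getElem_mem hlt)).1
      (hSI _ (List.getElem_mem (hl i))).2 (hsI i) (hs01 j) hss isPreconnected_connectedComponentIn
      (hCsub.trans Set.inter_subset_left) m1 m2 with h | h
    · exact hne _ (hgA _ (List.getElem_mem hlt)) (hCsub h).2
    · exact hne _ (hgA _ (List.getElem_mem (hl i))) (hCsub h).2

lemma cr_le_one (α β c : ℝ) (p q : Pt) : cr α β c p q ≤ 1 := by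
  unfold cr; split_ifs <;> norm_num

lemma cyc_le (α β c : ℝ) (T : List Pt) : cyc (cr α β c) T ≤ pth (cr α β c) T + 1 := by
  unfold cyc
  split_ifs with h
  · linarith [cr_le_one α β c (T.getLast h) (T.head h)]
  · linarith

lemma col_case (X : Finset Pt) (v : Pt) (hv : v ≠ 0) (c : ℝ) (hX : ∀ z ∈ X, fi v z = c)
    (D : ℕ) (hD : 6 ≤ D) : ∃ J, IsJordanCurve J ∧ StabLE J D ∧ (↑X : Set Pt) ⊆ J := by
  have hpos := norm_pos' hv
  set nn := v.1 ^ 2 + v.2 ^ 2 with hnn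
  obtain ⟨K, hK⟩ : ∃ K : ℝ, ∀ z ∈ X, |si v z| ≤ K := by
    obtain ⟨K, hK⟩ := (X.image fun z => |si v z|).bddAbove
    exact ⟨K, fun z hz => hK (by simpa using ⟨z.1, z.2, hz, rfl⟩)⟩
  -- point with prescribed coordinates
  let pt : ℝ → ℝ → Pt := fun x y => ((x * v.1 - y * v.2) / nn, (x * v.2 + y * v.1) / nn)
  have hs : ∀ x y, si v (pt x y) = x := by
    intro x y; simp only [si, pt]; field_simp; ring
  have hf : ∀ x y, fi v (pt x y) = y := by
    intro x y; simp only [fi, pt]; field_simp; ring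
  set R : ℝ := |K| + 1 with hR
  have hR0 : 0 < R := by positivity
  set u0 := pt (-R) c with hu0
  set u1 := pt R c with hu1
  set u2 := pt 0 (c + 1) with hu2
  have n01 : u0 ≠ u1 := by
    intro h; have := congrArg (si v) h; rw [hs, hs] at this; linarith
  have n02 : u0 ≠ u2 := by
    intro h; have := congrArg (fi v) h; rw [hf, hf] at this; linarith
  have n12 : u1 ≠ u2 := by
    intro h; have := congrArg (fi v) h; rw [hf, hf] at this; linarith
  obtain ⟨T, hT, hJ, hS⟩ := assemble (D := D) (T := [u0, u1, u2]) (by simp [n01, n02, n12]) (by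
    intro w hw d
    by_contra hcon
    push Not at hcon
    have e0 := hcon u0 (by simp)
    have e1 := hcon u1 (by simp)
    have e2 := hcon u2 (by simp)
    -- difference vectors
    have k1 : w.1 * v.2 - w.2 * v.1 = 0 := by
      have h : fi w u1 - fi w u0 = 2 * R / nn * (w.1 * v.2 - w.2 * v.1) := by
        simp only [fi, hu0, hu1, pt]; field_simp; ring
      have h' : 2 * R / nn * (w.1 * v.2 - w.2 * v.1) = 0 := by rw [← h]; linarith
      exact (mul_eq_zero.1 h').resolve_left (by positivity)
    have k2 : w.1 * v.1 + w.2 * v.2 = 0 := by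
      have h : fi w u2 - (fi w u0 + fi w u1) / 2 = 1 / nn * (w.1 * v.1 + w.2 * v.2) := by
        simp only [fi, hu0, hu1, hu2, pt]; field_simp; ring
      have h' : 1 / nn * (w.1 * v.1 + w.2 * v.2) = 0 := by rw [← h]; linarith
      exact (mul_eq_zero.1 h').resolve_left (by positivity)
    apply hw
    ext
    · apply mul_left_cancel₀ hpos.ne'
      simp only [Prod.fst_zero]
      linear_combination v.1 * k2 + v.2 * k1
    · apply mul_left_cancel₀ hpos.ne'
      simp only [Prod.snd_zero]
      linear_combination v.2 * k2 - v.1 * k1) (by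
    intro α β d _
    refine (cyc_le α β d _).trans ?_
    simp only [pth]
    have h1 := cr_le_one α β d u0 u1
    have h2 := cr_le_one α β d u1 u2
    have : (6 : ℝ) ≤ D := by exact_mod_cast hD
    linarith)
  refine ⟨_, hJ, hS, ?_⟩
  intro z hz
  have hw : Wbtw ℝ u0 z u1 := by
    have h1 := abs_le.1 (hK z hz)
    have h2 := le_abs_self K
    exact wbtw_of_coord hv (hf _ _) (hf _ _) (hX z hz) (by rw [hs]; linarith) (by rw [hs]; linarith)
  have hlen : T.length = 3 := hT.length_eq
  obtain ⟨x, y, w, rfl⟩ := List.length_eq_three.1 hlen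
  have m0 : u0 ∈ [x, y, w] := hT.mem_iff.2 (by simp)
  have m1 : u1 ∈ [x, y, w] := hT.mem_iff.2 (by simp)
  have c0 : cx [x, y, w] 0 = x := rfl
  have c1 : cx [x, y, w] 1 = y := rfl
  have c2 : cx [x, y, w] 2 = w := rfl
  have c3 : cx [x, y, w] 3 = x := by simp [cx]
  have key : Wbtw ℝ x z y ∨ Wbtw ℝ y z w ∨ Wbtw ℝ w z x := by
    simp only [List.mem_cons, List.not_mem_nil, or_false] at m0 m1
    have hw' := hw.symm
    rcases m0 with h | h | h <;> rcases m1 with h' | h' | h' <;> rw [h, h'] at n01 hw hw' <;>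
      first | exact absurd rfl n01 | tauto
  rcases key with h | h | h
  · exact ⟨0, by simp, by rwa [c0, c1]⟩
  · exact ⟨1, by simp, by rwa [c1, c2]⟩
  · exact ⟨2, by simp, by rwa [c2, c3]⟩

end Stab

/-- Lemma 4.5. -/
theorem stmt_11 (A B : Finset Pt) (hsep : LinSep ↑A ↑B) (a b : ℕ)
    (ha : 2 ≤ a) (hb : 2 ≤ b)
    (hA : ∃ JA, IsJordanCurve JA ∧ StabLE JA a ∧ (↑A : Set Pt) ⊆ JA)
    (hB : ∃ JB, IsJordanCurve JB ∧ StabLE JB b ∧ (↑B : Set Pt) ⊆ JB) :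
    ∃ J, IsJordanCurve J ∧ StabLE J (a + b + 2) ∧
      ((↑A : Set Pt) ∪ (↑B : Set Pt)) ⊆ J := by

  classical
  obtain ⟨JA, hJA, hSA, hAJ⟩ := hA
  obtain ⟨JB, hJB, hSB, hBJ⟩ := hB
  by_cases hcol : ∃ v : Pt, v ≠ 0 ∧ ∃ c, ∀ z ∈ A ∪ B, Stab.fi v z = c
  · obtain ⟨v, hv, c, h⟩ := hcol
    obtain ⟨J, h1, h2, h3⟩ := Stab.col_case (A ∪ B) v hv c h (a + b + 2) (by omega)
    exact ⟨J, h1, h2, by simpa using h3⟩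
  push Not at hcol
  obtain ⟨LA, nA, mA, cA⟩ := Stab.list_of_curve A a JA hJA hSA hAJ
  obtain ⟨LB, nB, mB, cB⟩ := Stab.list_of_curve B b JB hJB hSB hBJ
  obtain ⟨α, β, c, -, s1, s2⟩ := hsep
  obtain ⟨T, hT, hJ, hS⟩ := Stab.assemble (D := a + b + 2) (T := LA ++ LB) (by
    refine List.nodup_append.2 ⟨nA, nB, ?_⟩
    rintro x hx y hy rfl
    have h1 := s1 x ((mA x).1 hx)
    have h2 := s2 x ((mB x).1 hy)
    linarith) (by
    intro v hv c
    obtain ⟨z, hz, h⟩ := hcol v hv c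
    refine ⟨z, ?_, h⟩
    rw [List.mem_append, mA, mB]
    exact Finset.mem_union.1 hz) (by
    intro α β c hab
    have h1 := cA α β c hab
    have h2 := cB α β c hab
    refine (Stab.cyc_le α β c _).trans ?_
    push_cast
    by_cases hA : LA = []
    · subst hA
      simp only [List.nil_append, Stab.pth] at h1 ⊢
      linarith
    by_cases hB : LB = []
    · subst hB
      simp only [List.append_nil, Stab.pth] at h2 ⊢
      linarith
    rw [Stab.pth_append _ _ _ hA hB]
    linarith [Stab.cr_le_one α β c (LA.getLast hA) (LB.head hB)])
  refine ⟨_, hJ, hS, ?_⟩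
  intro z hz
  have hz' : z ∈ T := by
    rw [hT.mem_iff, List.mem_append, mA, mB]; exact hz
  obtain ⟨i, hi, rfl⟩ := List.getElem_of_mem hz'
  refine ⟨i, hi, ?_⟩
  rw [Stab.cx_lt T hi]
  exact wbtw_self_left ℝ _ _
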